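/- For every ε > 0 there exists l₀ such that for every prime N and every subset B ⊆ ℤ/Nℤ with |B| ≥ l₀ one has |B + B| ≤ (1 + ε)·|B ∔ B|. -/

import Mathlib

open Finset Pointwise

/-- The restricted sumset `X ∔ Y = {x + y : x ∈ X, y ∈ Y, x ≠ y}`. -/
def rsum {α : Type*} [DecidableEq α] [Add α] (A B : Finset α) : Finset α :=
  ((A ×ˢ B).filter fun p => p.1 ≠ p.2).image fun p => p.1 + p.2

open SimpleGraph TripartiteFromTriangles in
/-- A set with no nontrivial three-term arithmetic progression and with small doubling has bounded
size. -/
theorem exists_card_le_of_threeAPFree_of_card_add_le (K : ℝ) :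
    ∃ C : ℝ, 0 ≤ C ∧ ∀ (G : Type) [AddCommGroup G] [DecidableEq G] (S : Finset G),
      ThreeAPFree (S : Set G) → ((S + S).card : ℝ) ≤ K * S.card → (S.card : ℝ) ≤ C := by
  set M : ℝ := 1 + |K| + |K| ^ 3 with hM
  have hM0 : 0 < M := by positivity
  set δ : ℝ := (M ^ 2)⁻¹ with hδ
  have hδ0 : 0 < δ := by positivity
  have hr := triangleRemovalBound_pos hδ0
  refine ⟨(triangleRemovalBound δ)⁻¹, by positivity, fun G _ _ S hS hK => ?_⟩
  obtain rfl | hne := S.eq_empty_or_nonempty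
  · simpa using hr.le
  have hn : (0 : ℝ) < S.card := by exact_mod_cast hne.card_pos
  have hK' : ((S + S).card : ℝ) ≤ |K| * S.card := hK.trans (by gcongr; exact le_abs_self K)
  have h3 : ((S + S + S).card : ℝ) ≤ |K| ^ 3 * S.card := by
    have h := pluennecke_ruzsa_inequality_nsmul_add hne S 3
    have h' : ((3 • S).card : ℝ) ≤ ((S + S).card / S.card : ℝ) ^ 3 * S.card := by
      have hcast := NNRat.cast_mono (K := ℝ) h
      push_cast at hcast
      exact hcast
    rw [show 3 • S = S + S + S by rw [succ_nsmul, two_nsmul]] at h'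
    refine h'.trans ?_
    gcongr
    rwa [div_le_iff₀ hn]
  let t : Finset ({x // x ∈ S} × {x // x ∈ S + S} × {x // x ∈ S + S + S}) :=
    univ.filter fun p =>
      p.2.1.1 - p.1.1 ∈ S ∧ p.2.2.1 - p.2.1.1 = p.2.1.1 - p.1.1
  have ht : t.card = S.card ^ 2 := by
    rw [sq, ← card_product]
    refine card_bij (fun p _ => (p.1.1, p.2.1.1 - p.1.1)) ?_ ?_ ?_
    · rintro ⟨⟨a, ha⟩, ⟨b, hb⟩, ⟨c, hc⟩⟩ h
      simp only [t, mem_filter, mem_univ, true_and] at h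
      simp [ha, h.1]
    · rintro ⟨⟨a, ha⟩, ⟨b, hb⟩, ⟨c, hc⟩⟩ h ⟨⟨a', ha'⟩, ⟨b', hb'⟩, ⟨c', hc'⟩⟩ h' he
      simp only [t, mem_filter, mem_univ, true_and] at h h'
      simp only [Prod.mk.injEq] at he
      obtain ⟨rfl, he⟩ := he
      obtain rfl := sub_left_injective he
      obtain rfl := sub_left_injective (h.2.trans h'.2.symm)
      rfl
    · rintro ⟨x, a⟩ h
      obtain ⟨hx, ha⟩ := mem_product.1 h
      exact ⟨(⟨x, hx⟩, ⟨x + a, add_mem_add hx ha⟩, ⟨x + a + a, add_mem_add (add_mem_add hx ha) ha⟩),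
        by simpa [t] using ha, by simp⟩
  have : ExplicitDisjoint t := by
    refine ⟨?_, ?_, ?_⟩
    · rintro ⟨a, ha⟩ ⟨b, hb⟩ ⟨c, hc⟩ ⟨a', ha'⟩ h h'
      simp only [t, mem_filter, mem_univ, true_and] at h h'
      exact Subtype.ext (sub_right_injective (h.2.symm.trans h'.2))
    · rintro ⟨a, ha⟩ ⟨b, hb⟩ ⟨c, hc⟩ ⟨b', hb'⟩ h h'
      simp only [t, mem_filter, mem_univ, true_and] at h h'
      refine Subtype.ext (sub_left_injective (hS h.1 h'.1 h.1 ?_))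
      beta_reduce
      nth_rewrite 1 [← h.2]
      nth_rewrite 1 [← h'.2]
      abel
    · rintro ⟨a, ha⟩ ⟨b, hb⟩ ⟨c, hc⟩ ⟨c', hc'⟩ h h'
      simp only [t, mem_filter, mem_univ, true_and] at h h'
      exact Subtype.ext (sub_left_injective (h.2.trans h'.2.symm))
  have : NoAccidental t := by
    refine ⟨?_⟩
    rintro ⟨a, ha⟩ ⟨a', ha'⟩ ⟨b, hb⟩ ⟨b', hb'⟩ ⟨c, hc⟩ ⟨c', hc'⟩ h₀ h₁ h₂
    simp only [t, mem_filter, mem_univ, true_and] at h₀ h₁ h₂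
    refine Or.inr (Or.inl (Subtype.ext (sub_left_injective (hS h₂.1 h₁.1 h₀.1 ?_))))
    beta_reduce
    rw [← h₀.2]
    nth_rewrite 1 [← h₁.2]
    abel
  have hfar : (graph t).FarFromTriangleFree δ := by
    refine farFromTriangleFree t ?_
    simp only [Fintype.card_coe, ht]
    push_cast
    calc δ * ((S.card : ℝ) + (S + S).card + (S + S + S).card) ^ 2
        ≤ δ * (M * S.card) ^ 2 := by
          gcongr
          rw [hM]
          linarith
      _ = (S.card : ℝ) ^ 2 := by
          rw [hδ, mul_pow, inv_mul_cancel_left₀ (by positivity)]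
  have hcount := hfar.le_card_cliqueFinset
  rw [card_triangles, ht] at hcount
  simp only [Fintype.card_sum, Fintype.card_coe] at hcount
  push_cast at hcount
  have h5 : triangleRemovalBound δ * (S.card : ℝ) ^ 3 ≤ (S.card : ℝ) ^ 2 := by
    refine le_trans ?_ hcount
    gcongr
    linarith [Nat.cast_nonneg (α := ℝ) (S + S).card, Nat.cast_nonneg (α := ℝ) (S + S + S).card]
  rw [← one_div, le_div_iff₀' hr]
  refine le_of_mul_le_mul_right ?_ (pow_pos hn 2)
  linarith

theorem mem_rsum {α : Type*} [DecidableEq α] [Add α] {A B : Finset α} {x : α} :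
    x ∈ rsum A B ↔ ∃ a ∈ A, ∃ b ∈ B, a ≠ b ∧ a + b = x := by
  simp only [rsum, mem_image, mem_filter, mem_product, Prod.exists]
  constructor
  · rintro ⟨a, b, ⟨⟨ha, hb⟩, hab⟩, h⟩
    exact ⟨a, ha, b, hb, hab, h⟩
  · rintro ⟨a, ha, b, hb, hab, h⟩
    exact ⟨a, b, ⟨⟨ha, hb⟩, hab⟩, h⟩

theorem card_le_card_rsum_self_add_one {G : Type*} [AddCommGroup G] [DecidableEq G]
    (B : Finset G) : B.card ≤ (rsum B B).card + 1 := by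
  obtain rfl | ⟨b, hb⟩ := B.eq_empty_or_nonempty
  · simp
  rw [← card_erase_add_one hb]
  refine Nat.add_le_add_right ?_ 1
  refine card_le_card_of_injOn (fun x => x + b) (fun x hx => ?_) (add_left_injective b).injOn
  obtain ⟨hxb, hx⟩ := mem_erase.1 hx
  exact mem_rsum.2 ⟨x, hx, b, hb, hxb, rfl⟩

/-- For every `ε > 0` there is `l₀` such that for every prime `N` and every
`B ⊆ ℤ/Nℤ` with `|B| ≥ l₀` one has `|B + B| ≤ (1 + ε)|B ∔ B|`. -/
theorem statement5 (ε : ℝ) (hε : 0 < ε) :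
    ∃ l₀ : ℕ, ∀ N : ℕ, N.Prime → ∀ B : Finset (ZMod N), l₀ ≤ B.card →
      ((B + B).card : ℝ) ≤ (1 + ε) * ((rsum B B).card : ℝ) := by
  obtain ⟨C, hC0, hC⟩ := exists_card_le_of_threeAPFree_of_card_add_le (1 + ε⁻¹)
  refine ⟨⌈C / ε⌉₊ + 3, fun N hN B hB => ?_⟩
  have : Fact N.Prime := ⟨hN⟩
  have hN2 : N ≠ 2 := by
    rintro rfl
    have := card_le_univ B
    rw [ZMod.card] at this
    omega
  have two_ne : (2 : ZMod N) ≠ 0 := by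
    intro h
    have h' : ((2 : ℕ) : ZMod N) = 0 := by exact_mod_cast h
    rw [ZMod.natCast_eq_zero_iff] at h'
    exact hN2 ((Nat.prime_dvd_prime_iff_eq hN Nat.prime_two).1 h')
  set S : Finset (ZMod N) := B.filter fun b => b + b ∉ rsum B B with hSdef
  have hSB : S ⊆ B := filter_subset _ _
  have hcover : (B + B).card ≤ (rsum B B).card + S.card := by
    have hsub : B + B ⊆ rsum B B ∪ S.image fun b => b + b := by
      intro x hx
      obtain ⟨a, ha, b, hb, rfl⟩ := mem_add.1 hx
      by_cases h : a + b ∈ rsum B B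
      · exact mem_union_left _ h
      · obtain rfl : a = b := by
          by_contra hab
          exact h (mem_rsum.2 ⟨a, ha, b, hb, hab, rfl⟩)
        exact mem_union_right _ (mem_image.2 ⟨a, mem_filter.2 ⟨ha, h⟩, rfl⟩)
    exact (card_le_card hsub).trans
      ((card_union_le _ _).trans (Nat.add_le_add_left card_image_le _))
  have hcover' : ((B + B).card : ℝ) ≤ (rsum B B).card + S.card := by exact_mod_cast hcover
  by_contra! hlt
  have hS : ε * (rsum B B).card < S.card := by linarith
  have hfree : ThreeAPFree (S : Set (ZMod N)) := by
    intro a ha b hb c hc habc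
    have hac : a = c := by
      by_contra hac
      exact (mem_filter.1 hb).2 (mem_rsum.2 ⟨a, hSB ha, c, hSB hc, hac, habc⟩)
    rw [← hac, ← two_mul, ← two_mul] at habc
    exact mul_left_cancel₀ two_ne habc
  have hdoubling : ((S + S).card : ℝ) ≤ (1 + ε⁻¹) * S.card := by
    have h1 : ((S + S).card : ℝ) ≤ (B + B).card := by
      exact_mod_cast card_le_card (add_subset_add hSB hSB)
    have h2 : ((rsum B B).card : ℝ) ≤ ε⁻¹ * S.card := by
      rw [inv_mul_eq_div, le_div_iff₀' hε]
      exact hS.le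
    linarith
  have hSC := hC _ S hfree hdoubling
  have hle : ((B.card : ℕ) : ℝ) ≤ (rsum B B).card + 1 := by
    exact_mod_cast card_le_card_rsum_self_add_one B
  have hB' : C / ε + 3 ≤ B.card := by
    have h : ((⌈C / ε⌉₊ + 3 : ℕ) : ℝ) ≤ B.card := by exact_mod_cast hB
    push_cast at h
    linarith [Nat.le_ceil (C / ε)]
  have hfin : C / ε < (rsum B B).card := by linarith
  rw [div_lt_iff₀' hε] at hfin
  linarith
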